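/- Let γ ≥ 0 and let z ∈ ℂ with |z| = 1 and z ≠ 1. Then the modified fractional power of the Hankel–Clifford transform J_{z,γ} maps S(ℝ₊) into S(ℝ₊), and it is continuous: for every j ∈ ℕ₀ there exist C > 0 and j' ∈ ℕ₀ such that q_j(J_{z,γ} f) ≤ C q_{j'}(f) for all f ∈ S(ℝ₊). -/

import Mathlib

open MeasureTheory Filter Finset

noncomputable section

/-- The space `S(ℝ₊)`. -/
def IsSPlus1 (f : ℝ → ℂ) : Prop :=
  ContDiffOn ℝ (⊤ : ℕ∞) f (Set.Ioi 0) ∧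
  (∀ p : ℕ, ∃ g : ℝ → ℂ, ContinuousOn g (Set.Ici 0) ∧ ∀ t > (0:ℝ), g t = deriv^[p] f t) ∧
  (∀ k p : ℕ, ∃ C : ℝ, ∀ t > (0:ℝ), t ^ k * ‖deriv^[p] f t‖ ≤ C)

/-- The entire function `K_γ(u) = ∑ u^k/(k! Γ(k+γ+1))`. -/
def Kfun (γ : ℝ) (u : ℂ) : ℂ :=
  ∑' k : ℕ, u ^ k / ((k.factorial : ℂ) * Complex.Gamma ((k : ℂ) + (γ : ℂ) + 1))

/-- Modified fractional power of the Hankel-Clifford transform on `ℝ₊`: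
`J_{z,γ} f(t) = (1−z)^{−1−γ} ∫₀^∞ f(x) x^γ K_γ(x t z/(1−z)²) dx`. -/
def J1 (z : ℂ) (γ : ℝ) (f : ℝ → ℂ) : ℝ → ℂ :=
  fun t => (1 - z) ^ ((-1 : ℂ) - (γ : ℂ)) *
    ∫ x in Set.Ioi (0:ℝ), f x * (x : ℂ) ^ (γ : ℂ) *
      Kfun γ ((x : ℂ) * (t : ℂ) * z / (1 - z)^2)

/-! ### The kernel on the real line -/

/-- The coefficients of the entire function `Kfun γ`. -/
def kernelCoeff (γ : ℝ) (k : ℕ) : ℝ := 1 / ((k.factorial : ℝ) * Real.Gamma (k + γ + 1))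

/-- The restriction of `Kfun γ` to the real line. -/
def realKernel (γ : ℝ) (u : ℝ) : ℝ := ∑' k : ℕ, kernelCoeff γ k * u ^ k

theorem Kfun_ofReal (γ u : ℝ) : Kfun γ (u : ℂ) = (realKernel γ u : ℂ) := by
  unfold Kfun realKernel kernelCoeff
  rw [Complex.ofReal_tsum]
  refine tsum_congr fun k => ?_
  have h : Complex.Gamma ((k : ℂ) + (γ : ℂ) + 1) = (Real.Gamma (k + γ + 1) : ℂ) := by
    rw [← Complex.Gamma_ofReal]; push_cast; rfl
  rw [h]; push_cast; ring

theorem Gamma_le_Gamma_nat_add {γ : ℝ} (hγ : 0 ≤ γ) (k : ℕ) :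
    Real.Gamma (γ + 1) ≤ Real.Gamma (k + γ + 1) := by
  induction k with
  | zero => simp
  | succ k ih =>
    have hk : (0 : ℝ) ≤ k := k.cast_nonneg
    have e : ((k + 1 : ℕ) : ℝ) + γ + 1 = (k + γ + 1) + 1 := by push_cast; ring
    rw [e, Real.Gamma_add_one (s := k + γ + 1) (by positivity)]
    have hpos : 0 < Real.Gamma (k + γ + 1) := Real.Gamma_pos_of_pos (by positivity)
    nlinarith

theorem kernelCoeff_nonneg {γ : ℝ} (hγ : 0 ≤ γ) (k : ℕ) : 0 ≤ kernelCoeff γ k := by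
  have hpos : 0 < Real.Gamma (k + γ + 1) := Real.Gamma_pos_of_pos (by positivity)
  unfold kernelCoeff; positivity

theorem summable_kernelCoeff_mul_pow {γ : ℝ} (hγ : 0 ≤ γ) (u : ℝ) :
    Summable fun k => kernelCoeff γ k * u ^ k := by
  have hG : 0 < Real.Gamma (γ + 1) := Real.Gamma_pos_of_pos (by positivity)
  refine .of_norm_bounded
    ((Real.summable_pow_div_factorial |u|).mul_left (1 / Real.Gamma (γ + 1))) fun k => ?_
  have hk : 0 < Real.Gamma (k + γ + 1) := Real.Gamma_pos_of_pos (by positivity)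
  have hfac : (0 : ℝ) < k.factorial := by positivity
  rw [norm_mul, norm_pow, Real.norm_eq_abs, Real.norm_eq_abs,
    abs_of_nonneg (kernelCoeff_nonneg hγ k), kernelCoeff]
  calc 1 / ((k.factorial : ℝ) * Real.Gamma (k + γ + 1)) * |u| ^ k
      ≤ 1 / ((k.factorial : ℝ) * Real.Gamma (γ + 1)) * |u| ^ k := by
        gcongr
        exact Gamma_le_Gamma_nat_add hγ k
    _ = 1 / Real.Gamma (γ + 1) * (|u| ^ k / k.factorial) := by field_simp

theorem succ_mul_kernelCoeff_succ (γ : ℝ) (k : ℕ) :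
    kernelCoeff γ (k + 1) * ((k + 1 : ℕ) : ℝ) = kernelCoeff (γ + 1) k := by
  unfold kernelCoeff
  have e : ((k + 1 : ℕ) : ℝ) + γ + 1 = k + (γ + 1) + 1 := by push_cast; ring
  rw [e, Nat.factorial_succ]
  push_cast
  have : (k : ℝ) + 1 ≠ 0 := by positivity
  field_simp

theorem kernelCoeff_add_one {γ : ℝ} (hγ : 0 ≤ γ) (k : ℕ) :
    (k + γ + 1) * kernelCoeff (γ + 1) k = kernelCoeff γ k := by
  unfold kernelCoeff
  have e : (k : ℝ) + (γ + 1) + 1 = (k + γ + 1) + 1 := by ring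
  have h : (k : ℝ) + γ + 1 ≠ 0 := by positivity
  rw [e, Real.Gamma_add_one h]
  field_simp

theorem hasDerivAt_realKernel {γ : ℝ} (hγ : 0 ≤ γ) (u : ℝ) :
    HasDerivAt (realKernel γ) (realKernel (γ + 1) u) u := by
  have hγ1 : 0 ≤ γ + 1 := by positivity
  have key : ∀ (v : ℝ) (k : ℕ), kernelCoeff γ (k + 1) * (((k + 1 : ℕ) : ℝ) * v ^ (k + 1 - 1)) =
      kernelCoeff (γ + 1) k * v ^ k := fun v k => by
    rw [← mul_assoc, succ_mul_kernelCoeff_succ, Nat.add_sub_cancel]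
  have hsum : ∀ v : ℝ, Summable fun k : ℕ => kernelCoeff γ k * ((k : ℝ) * v ^ (k - 1)) :=
    fun v => (summable_nat_add_iff 1).1 <| by
      simpa only [key] using summable_kernelCoeff_mul_pow hγ1 v
  have hval : realKernel (γ + 1) u = ∑' k : ℕ, kernelCoeff γ k * ((k : ℝ) * u ^ (k - 1)) := by
    rw [(hsum u).tsum_eq_zero_add]
    simp only [key]
    simp [realKernel]
  rw [hval]
  have hu : u ∈ Metric.ball (0 : ℝ) (|u| + 1) := by simp
  refine hasDerivAt_tsum_of_isPreconnected (hsum (|u| + 1)) Metric.isOpen_ball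
    (convex_ball _ _).isPreconnected (fun k y _ => (hasDerivAt_pow k y).const_mul _)
    (fun k y hy => ?_) hu (summable_kernelCoeff_mul_pow hγ u) hu
  have hy' : |y| ≤ |u| + 1 := by simpa using (Metric.mem_ball.1 hy).le
  rw [norm_mul, norm_mul, norm_pow, Real.norm_eq_abs, Real.norm_eq_abs, Real.norm_eq_abs,
    abs_of_nonneg (kernelCoeff_nonneg hγ k), Nat.abs_cast]
  have := kernelCoeff_nonneg hγ k
  gcongr

theorem continuous_realKernel {γ : ℝ} (hγ : 0 ≤ γ) : Continuous (realKernel γ) :=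
  continuous_iff_continuousAt.2 fun u => (hasDerivAt_realKernel hγ u).continuousAt

theorem realKernel_recurrence {γ : ℝ} (hγ : 0 ≤ γ) (u : ℝ) :
    u * realKernel (γ + 1 + 1) u + (γ + 1) * realKernel (γ + 1) u = realKernel γ u := by
  have hγ1 : 0 ≤ γ + 1 := by positivity
  have hγ2 : 0 ≤ γ + 1 + 1 := by positivity
  have hshift : ∀ k : ℕ, ((k + 1 : ℕ) : ℝ) * (kernelCoeff (γ + 1) (k + 1) * u ^ (k + 1)) =
      u * (kernelCoeff (γ + 1 + 1) k * u ^ k) := fun k => by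
    rw [← succ_mul_kernelCoeff_succ (γ + 1)]; ring
  have hs : Summable fun k : ℕ => (k : ℝ) * (kernelCoeff (γ + 1) k * u ^ k) :=
    (summable_nat_add_iff 1).1 <| by
      simpa only [hshift] using (summable_kernelCoeff_mul_pow hγ2 u).mul_left u
  have h1 : u * realKernel (γ + 1 + 1) u =
      ∑' k : ℕ, (k : ℝ) * (kernelCoeff (γ + 1) k * u ^ k) := by
    rw [hs.tsum_eq_zero_add]
    simp only [hshift]
    simp [realKernel, tsum_mul_left]
  rw [h1]
  unfold realKernel
  rw [← tsum_mul_left, ← hs.tsum_add ((summable_kernelCoeff_mul_pow hγ1 u).mul_left _)]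
  refine tsum_congr fun k => ?_
  rw [← kernelCoeff_add_one hγ]; ring

/-- On the negative half-line the kernel is bounded by its value at the origin, since the energy
`u * K_{γ+1}(-u)² + K_γ(-u)²` is nonincreasing in `u ≥ 0`. -/
theorem abs_realKernel_neg_le {γ : ℝ} (hγ : 0 ≤ γ) {u : ℝ} (hu : 0 ≤ u) :
    |realKernel γ (-u)| ≤ |realKernel γ 0| := by
  have hγ1 : 0 ≤ γ + 1 := by positivity
  let E : ℝ → ℝ := fun v => v * realKernel (γ + 1) (-v) ^ 2 + realKernel γ (-v) ^ 2
  have hE : ∀ v, HasDerivAt E (-(2 * γ + 1) * realKernel (γ + 1) (-v) ^ 2) v := fun v => by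
    have h0 := (hasDerivAt_realKernel hγ (-v)).comp v (hasDerivAt_neg v)
    have h1 := (hasDerivAt_realKernel hγ1 (-v)).comp v (hasDerivAt_neg v)
    refine (((hasDerivAt_id v).mul (h1.pow 2)).add (h0.pow 2)).congr_deriv ?_
    have hr := realKernel_recurrence hγ (-v)
    simp only [Function.comp_apply, id, Pi.pow_apply]
    rw [← hr]
    push_cast
    ring
  have hanti : Antitone E := antitone_of_hasDerivAt_nonpos hE fun v => by
    have := sq_nonneg (realKernel (γ + 1) (-v))
    simp only [Pi.zero_apply]
    nlinarith [mul_nonneg hγ this]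
  have h := hanti hu
  simp only [E, neg_zero, zero_mul, zero_add] at h
  refine sq_le_sq.1 (le_trans ?_ h)
  have := mul_nonneg hu (sq_nonneg (realKernel (γ + 1) (-u)))
  linarith

theorem hasDerivAt_rpow_mul_realKernel {γ : ℝ} (hγ : 0 ≤ γ) (a : ℝ) {x : ℝ} (hx : 0 < x) :
    HasDerivAt (fun y => y ^ (γ + 1) * realKernel (γ + 1) (a * y))
      (x ^ γ * realKernel γ (a * x)) x := by
  have hγ1 : 0 ≤ γ + 1 := by positivity
  have h1 : HasDerivAt (fun y => realKernel (γ + 1) (a * y))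
      (realKernel (γ + 1 + 1) (a * x) * a) x :=
    ((hasDerivAt_realKernel hγ1 (a * x)).comp x ((hasDerivAt_id x).const_mul a)).congr_deriv
      (by simp)
  have h2 := Real.hasDerivAt_rpow_const (p := γ + 1) (Or.inl hx.ne')
  refine (h2.mul h1).congr_deriv ?_
  rw [← realKernel_recurrence hγ (a * x), add_sub_cancel_right, Real.rpow_add_one hx.ne']
  ring

/-! ### Rapid decay and jets -/

/-- The weighted sup-norms `sup_{x > 0} x ^ k ‖g x‖`, `k ≤ N`, are bounded by `M`. -/
def DecayBound (g : ℝ → ℂ) (N : ℕ) (M : ℝ) : Prop :=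
  ∀ k ≤ N, ∀ x > (0 : ℝ), x ^ k * ‖g x‖ ≤ M

theorem DecayBound.nonneg {g : ℝ → ℂ} {N : ℕ} {M : ℝ} (h : DecayBound g N M) : 0 ≤ M :=
  le_trans (by positivity) (h 0 N.zero_le 1 one_pos)

theorem DecayBound.mono {g : ℝ → ℂ} {N N' : ℕ} {M : ℝ} (h : DecayBound g N M) (hN : N' ≤ N) :
    DecayBound g N' M :=
  fun k hk => h k (hk.trans hN)

theorem DecayBound.rpow_mul_norm_le {g : ℝ → ℂ} {γ M : ℝ} (hγ : 0 ≤ γ)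
    (h : DecayBound g (⌈γ⌉₊ + 2) M) {x : ℝ} (hx : 0 < x) :
    x ^ γ * ‖g x‖ ≤ 4 * M * (1 + x ^ 2)⁻¹ := by
  have hw : x ^ γ ≤ 1 + x ^ ⌈γ⌉₊ := by
    rcases le_total x 1 with h1 | h1
    · have := Real.rpow_le_one hx.le h1 hγ
      have := pow_nonneg hx.le ⌈γ⌉₊
      linarith
    · have := Real.rpow_le_rpow_of_exponent_le h1 (Nat.le_ceil γ)
      rw [Real.rpow_natCast] at this
      linarith
  rw [← div_eq_mul_inv, le_div_iff₀ (by positivity)]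
  have h0 := h 0 (by omega) x hx
  have h2 := h 2 (by omega) x hx
  have h3 := h ⌈γ⌉₊ (by omega) x hx
  have h4 := h (⌈γ⌉₊ + 2) le_rfl x hx
  calc x ^ γ * ‖g x‖ * (1 + x ^ 2) ≤ (1 + x ^ ⌈γ⌉₊) * ‖g x‖ * (1 + x ^ 2) := by gcongr
    _ = x ^ 0 * ‖g x‖ + x ^ 2 * ‖g x‖ + x ^ ⌈γ⌉₊ * ‖g x‖ + x ^ (⌈γ⌉₊ + 2) * ‖g x‖ := by ring
    _ ≤ 4 * M := by linarith

/-- All seminorms of order at most `N` of the jet `F` are bounded by `M`. -/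
def JetBound (F : ℕ → ℝ → ℂ) (N : ℕ) (M : ℝ) : Prop :=
  ∀ p ≤ N, DecayBound (F p) N M

theorem JetBound.mono {F : ℕ → ℝ → ℂ} {N N' : ℕ} {M : ℝ} (h : JetBound F N M) (hN : N' ≤ N) :
    JetBound F N' M :=
  fun p hp => (h p (hp.trans hN)).mono hN

/-- `F p` is the `p`-th derivative of `F 0` on the positive half-line, and all seminorms of `F 0`
are finite. -/
structure IsSchwartzJet (F : ℕ → ℝ → ℂ) : Prop where
  hasDerivAt : ∀ p, ∀ x > (0 : ℝ), HasDerivAt (F p) (F (p + 1) x) x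
  bounded : ∀ N, ∃ M, JetBound F N M

theorem IsSchwartzJet.continuousOn {F : ℕ → ℝ → ℂ} (hF : IsSchwartzJet F) (p : ℕ) :
    ContinuousOn (F p) (Set.Ioi 0) :=
  fun x hx => (hF.hasDerivAt p x hx).continuousAt.continuousWithinAt

theorem IsSchwartzJet.exists_decayBound {F : ℕ → ℝ → ℂ} (hF : IsSchwartzJet F) (p N : ℕ) :
    ∃ M, DecayBound (F p) N M := by
  obtain ⟨M, hM⟩ := hF.bounded (max p N)
  exact ⟨M, (hM p (le_max_left _ _)).mono (le_max_right _ _)⟩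

/-- The derivatives of `x f'' + a f'` in terms of the derivatives `F` of `f`. -/
def besselJet (a : ℝ) (F : ℕ → ℝ → ℂ) : ℕ → ℝ → ℂ :=
  fun p x => x • F (p + 2) x + ((p : ℝ) + a) • F (p + 1) x

theorem JetBound.besselJet {F : ℕ → ℝ → ℂ} {a M : ℝ} (ha : 0 ≤ a) {N : ℕ}
    (h : JetBound F (N + 2) M) : JetBound (besselJet a F) N ((1 + N + a) * M) := by
  intro p hp k hk x hx
  have hM : 0 ≤ M := (h 0 (by omega)).nonneg
  have h1 := h (p + 2) (by omega) (k + 1) (by omega) x hx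
  have h2 := h (p + 1) (by omega) k (by omega) x hx
  have hpN : (p : ℝ) ≤ N := by exact_mod_cast hp
  calc x ^ k * ‖_root_.besselJet a F p x‖
      ≤ x ^ k * (x * ‖F (p + 2) x‖ + (p + a) * ‖F (p + 1) x‖) := by
        gcongr
        refine (norm_add_le _ _).trans_eq ?_
        rw [norm_smul, norm_smul, Real.norm_of_nonneg hx.le,
          Real.norm_of_nonneg (by positivity : (0 : ℝ) ≤ p + a)]
    _ = x ^ (k + 1) * ‖F (p + 2) x‖ + (p + a) * (x ^ k * ‖F (p + 1) x‖) := by ring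
    _ ≤ M + (N + a) * M := by gcongr
    _ = (1 + N + a) * M := by ring

theorem IsSchwartzJet.besselJet {F : ℕ → ℝ → ℂ} (hF : IsSchwartzJet F) {a : ℝ} (ha : 0 ≤ a) :
    IsSchwartzJet (besselJet a F) where
  hasDerivAt p x hx := by
    refine (((hasDerivAt_id x).smul (hF.hasDerivAt (p + 2) x hx)).add
      ((hF.hasDerivAt (p + 1) x hx).const_smul ((p : ℝ) + a))).congr_deriv ?_
    simp only [_root_.besselJet, id, Nat.cast_add, Nat.cast_one, one_smul]
    module
  bounded N := by
    obtain ⟨M, hM⟩ := hF.bounded (N + 2)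
    exact ⟨_, hM.besselJet ha⟩

/-! ### The Hankel–Clifford integral -/

/-- The integral `∫₀^∞ x ^ γ K_γ(-c x t) g(x) dx`. -/
def hankelIntegral (γ c : ℝ) (g : ℝ → ℂ) (t : ℝ) : ℂ :=
  ∫ x in Set.Ioi (0 : ℝ), (x ^ γ * realKernel γ (-(c * x * t))) • g x

theorem norm_hankelIntegrand_le {γ c M : ℝ} (hγ : 0 ≤ γ) (hc : 0 ≤ c) {g : ℝ → ℂ}
    (hg : DecayBound g (⌈γ⌉₊ + 2) M) {t x : ℝ} (ht : 0 ≤ t) (hx : 0 < x) :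
    ‖(x ^ γ * realKernel γ (-(c * x * t))) • g x‖ ≤
      |realKernel γ 0| * (4 * M) * (1 + x ^ 2)⁻¹ := by
  rw [norm_smul, norm_mul, Real.norm_of_nonneg (Real.rpow_nonneg hx.le γ), Real.norm_eq_abs]
  calc x ^ γ * |realKernel γ (-(c * x * t))| * ‖g x‖
      ≤ x ^ γ * |realKernel γ 0| * ‖g x‖ := by
        gcongr x ^ γ * ?_ * ‖g x‖
        exact abs_realKernel_neg_le hγ (by positivity)
    _ = |realKernel γ 0| * (x ^ γ * ‖g x‖) := by ring
    _ ≤ |realKernel γ 0| * (4 * M * (1 + x ^ 2)⁻¹) := by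
        gcongr |realKernel γ 0| * ?_
        exact hg.rpow_mul_norm_le hγ hx
    _ = _ := by ring

theorem aestronglyMeasurable_hankelIntegrand {γ : ℝ} (hγ : 0 ≤ γ) (c t : ℝ) {g : ℝ → ℂ}
    (hg : ContinuousOn g (Set.Ioi 0)) :
    AEStronglyMeasurable (fun x => (x ^ γ * realKernel γ (-(c * x * t))) • g x)
      (volume.restrict (Set.Ioi (0 : ℝ))) := by
  have h1 : Continuous fun x : ℝ => realKernel γ (-(c * x * t)) :=
    (continuous_realKernel hγ).comp (by fun_prop)
  exact ContinuousOn.aestronglyMeasurable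
    (((Real.continuous_rpow_const hγ).mul h1).continuousOn.smul hg) measurableSet_Ioi

theorem integrableOn_hankelIntegrand {γ c M : ℝ} (hγ : 0 ≤ γ) (hc : 0 ≤ c) {g : ℝ → ℂ}
    (hcont : ContinuousOn g (Set.Ioi 0)) (hg : DecayBound g (⌈γ⌉₊ + 2) M) {t : ℝ} (ht : 0 ≤ t) :
    IntegrableOn (fun x => (x ^ γ * realKernel γ (-(c * x * t))) • g x) (Set.Ioi 0) := by
  refine Integrable.mono' ((integrable_inv_one_add_sq.integrableOn (s := Set.Ioi 0)).const_mul
    (|realKernel γ 0| * (4 * M))) (aestronglyMeasurable_hankelIntegrand hγ c t hcont) ?_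
  filter_upwards [ae_restrict_mem measurableSet_Ioi] with x hx
  exact norm_hankelIntegrand_le hγ hc hg ht hx

theorem norm_hankelIntegral_le {γ c M : ℝ} (hγ : 0 ≤ γ) (hc : 0 ≤ c) {g : ℝ → ℂ}
    (hg : DecayBound g (⌈γ⌉₊ + 2) M) {t : ℝ} (ht : 0 ≤ t) :
    ‖hankelIntegral γ c g t‖ ≤ |realKernel γ 0| * (4 * M) * Real.pi := by
  have hM := hg.nonneg
  calc ‖hankelIntegral γ c g t‖
      ≤ ∫ x in Set.Ioi (0 : ℝ), |realKernel γ 0| * (4 * M) * (1 + x ^ 2)⁻¹ := by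
        refine norm_integral_le_of_norm_le
          ((integrable_inv_one_add_sq.integrableOn (s := Set.Ioi 0)).const_mul _) ?_
        filter_upwards [ae_restrict_mem measurableSet_Ioi] with x hx
        exact norm_hankelIntegrand_le hγ hc hg ht hx
    _ = |realKernel γ 0| * (4 * M) * ∫ x in Set.Ioi (0 : ℝ), (1 + x ^ 2)⁻¹ :=
        integral_const_mul _ _
    _ ≤ |realKernel γ 0| * (4 * M) * Real.pi := by
        gcongr
        rw [← integral_univ_inv_one_add_sq]
        exact setIntegral_le_integral integrable_inv_one_add_sq
          (Eventually.of_forall fun x => by positivity)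

theorem continuousOn_hankelIntegral {γ c M : ℝ} (hγ : 0 ≤ γ) (hc : 0 ≤ c) {g : ℝ → ℂ}
    (hcont : ContinuousOn g (Set.Ioi 0)) (hg : DecayBound g (⌈γ⌉₊ + 2) M) :
    ContinuousOn (hankelIntegral γ c g) (Set.Ici 0) := by
  refine continuousOn_of_dominated (bound := fun x => |realKernel γ 0| * (4 * M) * (1 + x ^ 2)⁻¹)
    (fun t _ => aestronglyMeasurable_hankelIntegrand hγ c t hcont) (fun t ht => ?_)
    ((integrable_inv_one_add_sq.integrableOn (s := Set.Ioi 0)).const_mul _) ?_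
  · filter_upwards [ae_restrict_mem measurableSet_Ioi] with x hx
    exact norm_hankelIntegrand_le hγ hc hg ht hx
  · refine Eventually.of_forall fun x => Continuous.continuousOn ?_
    have := (continuous_realKernel hγ).comp (by fun_prop : Continuous fun t => -(c * x * t))
    exact (continuous_const.mul this).smul continuous_const

theorem hasDerivAt_hankelIntegral {γ c M M' : ℝ} (hγ : 0 ≤ γ) (hc : 0 ≤ c) {g : ℝ → ℂ}
    (hcont : ContinuousOn g (Set.Ioi 0)) (hg : DecayBound g (⌈γ⌉₊ + 2) M)
    (hg' : DecayBound g (⌈γ + 1⌉₊ + 2) M') {t : ℝ} (ht : 0 < t) :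
    HasDerivAt (hankelIntegral γ c g) (-c • hankelIntegral (γ + 1) c g t) t := by
  have hγ1 : 0 ≤ γ + 1 := by positivity
  have key := hasDerivAt_integral_of_dominated_loc_of_deriv_le
    (μ := volume.restrict (Set.Ioi (0 : ℝ))) (s := Set.Ioi (0 : ℝ))
    (F := fun t x => (x ^ γ * realKernel γ (-(c * x * t))) • g x)
    (F' := fun t x => -c • ((x ^ (γ + 1) * realKernel (γ + 1) (-(c * x * t))) • g x))
    (bound := fun x => c * (|realKernel (γ + 1) 0| * (4 * M') * (1 + x ^ 2)⁻¹))
    (Ioi_mem_nhds ht)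
    (Eventually.of_forall fun t => aestronglyMeasurable_hankelIntegrand hγ c t hcont)
    (integrableOn_hankelIntegrand hγ hc hcont hg ht.le)
    ((aestronglyMeasurable_hankelIntegrand hγ1 c t hcont).const_smul (-c))
    (by
      filter_upwards [ae_restrict_mem measurableSet_Ioi] with x hx s hs
      rw [norm_smul, norm_neg, Real.norm_of_nonneg hc]
      gcongr
      exact norm_hankelIntegrand_le hγ1 hc hg' (le_of_lt hs) hx)
    (((integrable_inv_one_add_sq.integrableOn (s := Set.Ioi 0)).const_mul _).const_mul c)
    (by
      filter_upwards [ae_restrict_mem measurableSet_Ioi] with x hx s _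
      have h1 : HasDerivAt (fun s => realKernel γ (-(c * x * s)))
          (realKernel (γ + 1) (-(c * x * s)) * -(c * x)) s :=
        (HasDerivAt.comp s (h := fun s => -(c * x * s)) (hasDerivAt_realKernel hγ _)
          ((hasDerivAt_id s).const_mul (c * x)).neg).congr_deriv (by simp)
      refine ((h1.const_mul (x ^ γ)).smul_const (g x)).congr_deriv ?_
      rw [Real.rpow_add_one (ne_of_gt hx), smul_smul]
      congr 1
      ring)
  refine key.2.congr_deriv ?_
  rw [integral_smul, hankelIntegral]

/-- The integral over the half-line of the derivative of `x ^ (γ + 1) k(x) g(x)` vanishes. -/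
theorem integral_deriv_rpow_mul_smul_eq_zero {γ B M : ℝ} (hγ : 0 ≤ γ) {k : ℝ → ℝ} {g D : ℝ → ℂ}
    (hk : ∀ x > (0 : ℝ), |k x| ≤ B) (hg : DecayBound g (⌈γ + 1⌉₊ + 2) M)
    (hderiv : ∀ x > (0 : ℝ), HasDerivAt (fun y => (y ^ (γ + 1) * k y) • g y) (D x) x)
    (hint : IntegrableOn D (Set.Ioi 0)) : ∫ x in Set.Ioi (0 : ℝ), D x = 0 := by
  have hγ1 : 0 < γ + 1 := by positivity
  have hM := hg.nonneg
  have hB : 0 ≤ B := (abs_nonneg _).trans (hk 1 one_pos)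
  have hbound : ∀ x > (0 : ℝ), ‖(x ^ (γ + 1) * k x) • g x‖ ≤ B * (x ^ (γ + 1) * ‖g x‖) :=
    fun x hx => by
      rw [norm_smul, norm_mul, Real.norm_of_nonneg (Real.rpow_nonneg hx.le _), Real.norm_eq_abs]
      calc x ^ (γ + 1) * |k x| * ‖g x‖ ≤ x ^ (γ + 1) * B * ‖g x‖ := by
            gcongr
            exact hk x hx
        _ = B * (x ^ (γ + 1) * ‖g x‖) := by ring
  have hzero : ((0 : ℝ) ^ (γ + 1) * k 0) • g 0 = 0 := by
    rw [Real.zero_rpow hγ1.ne', zero_mul, zero_smul]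
  have hcont : ContinuousWithinAt (fun y => (y ^ (γ + 1) * k y) • g y) (Set.Ici 0) 0 := by
    rw [ContinuousWithinAt, hzero]
    have hlim : Tendsto (fun x : ℝ => B * (x ^ (γ + 1) * M)) (nhdsWithin 0 (Set.Ici 0))
        (nhds 0) := by
      have hc : Continuous fun x : ℝ => B * (x ^ (γ + 1) * M) :=
        continuous_const.mul ((Real.continuous_rpow_const hγ1.le).mul continuous_const)
      have := (hc.tendsto 0).mono_left (nhdsWithin_le_nhds (s := Set.Ici 0))
      simpa [Real.zero_rpow hγ1.ne'] using this
    refine squeeze_zero_norm' ?_ hlim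
    filter_upwards [self_mem_nhdsWithin] with x hx
    rcases (Set.mem_Ici.1 hx).eq_or_lt with rfl | hx
    · rw [hzero, norm_zero, Real.zero_rpow hγ1.ne']; simp
    · refine (hbound x hx).trans ?_
      have := hg 0 (Nat.zero_le _) x hx
      rw [pow_zero, one_mul] at this
      have := Real.rpow_nonneg hx.le (γ + 1)
      gcongr
  have htop : Tendsto (fun y => (y ^ (γ + 1) * k y) • g y) atTop (nhds 0) := by
    have hlim : Tendsto (fun x : ℝ => B * (4 * M * (1 + x ^ 2)⁻¹)) atTop (nhds 0) := by
      have h1 : Tendsto (fun x : ℝ => (1 + x ^ 2)⁻¹) atTop (nhds 0) :=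
        tendsto_inv_atTop_zero.comp
          (tendsto_atTop_add_const_left _ _ (tendsto_pow_atTop two_ne_zero))
      simpa using (h1.const_mul (4 * M)).const_mul B
    refine squeeze_zero_norm' ?_ hlim
    filter_upwards [eventually_gt_atTop 0] with x hx
    refine (hbound x hx).trans ?_
    gcongr B * ?_
    exact hg.rpow_mul_norm_le hγ1.le hx
  rw [integral_Ioi_of_hasDerivAt_of_tendsto hcont (fun x hx => hderiv x hx) hint htop, hzero,
    sub_zero]

theorem hankelIntegral_eq_neg {F : ℕ → ℝ → ℂ} (hF : IsSchwartzJet F) {γ c : ℝ} (hγ : 0 ≤ γ)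
    (hc : 0 ≤ c) (p : ℕ) {t : ℝ} (ht : 0 ≤ t) :
    hankelIntegral γ c (F p) t = -hankelIntegral (γ + 1) c (F (p + 1)) t := by
  have hγ1 : 0 ≤ γ + 1 := by positivity
  obtain ⟨M₀, hM₀⟩ := hF.exists_decayBound p (⌈γ⌉₊ + 2)
  obtain ⟨M, hM⟩ := hF.exists_decayBound p (⌈γ + 1⌉₊ + 2)
  obtain ⟨M₁, hM₁⟩ := hF.exists_decayBound (p + 1) (⌈γ + 1⌉₊ + 2)
  have hi₀ := integrableOn_hankelIntegrand hγ hc (hF.continuousOn p) hM₀ ht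
  have hi₁ := integrableOn_hankelIntegrand hγ1 hc (hF.continuousOn (p + 1)) hM₁ ht
  have h := integral_deriv_rpow_mul_smul_eq_zero hγ
    (k := fun x => realKernel (γ + 1) (-(c * x * t)))
    (fun x hx => abs_realKernel_neg_le hγ1 (by positivity)) hM
    (fun x hx => by
      have e : ∀ y, -(c * y * t) = -(c * t) * y := fun y => by ring
      have h1 := (hasDerivAt_rpow_mul_realKernel hγ (-(c * t)) hx).smul (hF.hasDerivAt p x hx)
      simp only [← e] at h1
      exact h1) (hi₁.add hi₀)
  have h2 := integral_add hi₁ hi₀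
  exact eq_neg_of_add_eq_zero_right (h2.symm.trans h)

theorem mul_hankelIntegral_succ {F : ℕ → ℝ → ℂ} (hF : IsSchwartzJet F) {γ c : ℝ} (hγ : 0 ≤ γ)
    (hc : 0 ≤ c) {t : ℝ} (ht : 0 ≤ t) :
    (c * t) • hankelIntegral (γ + 1) c (F 1) t =
      hankelIntegral γ c (besselJet (γ + 1) F 0) t := by
  have hγ1 : 0 ≤ γ + 1 := by positivity
  have hL := hF.besselJet hγ1
  obtain ⟨M₀, hM₀⟩ := hL.exists_decayBound 0 (⌈γ⌉₊ + 2)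
  obtain ⟨M, hM⟩ := hF.exists_decayBound 1 (⌈γ + 1⌉₊ + 2)
  have hi₀ := integrableOn_hankelIntegrand hγ hc (hL.continuousOn 0) hM₀ ht
  have hi₁ := (integrableOn_hankelIntegrand hγ1 hc (hF.continuousOn 1) hM ht).smul (c * t)
  have h := integral_deriv_rpow_mul_smul_eq_zero hγ (k := fun x => realKernel γ (-(c * x * t)))
    (fun x hx => abs_realKernel_neg_le hγ (by positivity)) hM
    (fun x hx => by
      have h0 := Real.hasDerivAt_rpow_const (p := γ + 1) (Or.inl (ne_of_gt hx))
      have h1 : HasDerivAt (fun y => realKernel γ (-(c * y * t)))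
          (realKernel (γ + 1) (-(c * x * t)) * -(c * t)) x :=
        (HasDerivAt.comp x (h := fun y => -(c * y * t)) (hasDerivAt_realKernel hγ _)
          (((hasDerivAt_id x).const_mul c).mul_const t).neg).congr_deriv (by simp)
      refine ((h0.mul h1).smul (hF.hasDerivAt 1 x hx)).congr_deriv
        (g' := (x ^ γ * realKernel γ (-(c * x * t))) • besselJet (γ + 1) F 0 x -
          (c * t) • ((x ^ (γ + 1) * realKernel (γ + 1) (-(c * x * t))) • F 1 x)) ?_
      simp only [besselJet, add_sub_cancel_right, Real.rpow_add_one (ne_of_gt hx), Pi.mul_apply,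
        Nat.cast_zero, zero_add]
      module) (hi₀.sub hi₁)
  have h2 := integral_sub hi₀ hi₁
  have h3 := sub_eq_zero.1 (h2.symm.trans h)
  rw [hankelIntegral, hankelIntegral, h3]
  exact (integral_smul _ _).symm

theorem mul_hankelIntegral {F : ℕ → ℝ → ℂ} (hF : IsSchwartzJet F) {γ c : ℝ} (hγ : 0 ≤ γ)
    (hc : 0 ≤ c) {t : ℝ} (ht : 0 ≤ t) :
    (c * t) • hankelIntegral γ c (F 0) t =
      -hankelIntegral γ c (besselJet (γ + 1) F 0) t := by
  rw [hankelIntegral_eq_neg hF hγ hc 0 ht, smul_neg, mul_hankelIntegral_succ hF hγ hc ht]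

/-- Each weighted sup-norm of the Hankel–Clifford integral is controlled by a seminorm. -/
theorem exists_pow_mul_norm_hankelIntegral_le {γ c : ℝ} (hγ : 0 ≤ γ) (hc : 0 < c) (k : ℕ) :
    ∃ C ≥ (0 : ℝ), ∃ N : ℕ, ∀ F, IsSchwartzJet F → ∀ M, JetBound F N M →
      ∀ t > (0 : ℝ), t ^ k * ‖hankelIntegral γ c (F 0) t‖ ≤ C * M := by
  induction k with
  | zero =>
    refine ⟨|realKernel γ 0| * 4 * Real.pi, by positivity, ⌈γ⌉₊ + 2, fun F _ M hM t ht => ?_⟩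
    have := norm_hankelIntegral_le hγ hc.le (hM 0 (Nat.zero_le _)) ht.le
    linarith
  | succ k ih =>
    obtain ⟨C, hC, N, h⟩ := ih
    have hγ1 : 0 ≤ γ + 1 := by positivity
    refine ⟨c⁻¹ * (C * (1 + N + (γ + 1))), by positivity, N + 2, fun F hF M hM t ht => ?_⟩
    have h1 := h _ (hF.besselJet hγ1) _ (hM.besselJet hγ1) t ht
    have h2 := congrArg norm (mul_hankelIntegral hF hγ hc.le ht.le)
    rw [norm_smul, norm_neg, Real.norm_of_nonneg (by positivity)] at h2
    rw [← h2] at h1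
    rw [mul_assoc, inv_mul_eq_div, le_div_iff₀ hc]
    calc t ^ (k + 1) * ‖hankelIntegral γ c (F 0) t‖ * c
        = t ^ k * (c * t * ‖hankelIntegral γ c (F 0) t‖) := by ring
      _ ≤ _ := h1
      _ = _ := by ring

/-! ### The derivatives of the transform -/

/-- The jet formed by the iterated derivatives of `f`. -/
theorem IsSPlus1.isSchwartzJet {f : ℝ → ℂ} (hf : IsSPlus1 f) :
    IsSchwartzJet fun p => deriv^[p] f where
  hasDerivAt p x hx := by
    have h : ∀ p, ContDiffOn ℝ (⊤ : ℕ∞) (deriv^[p] f) (Set.Ioi 0) := fun p => by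
      induction p with
      | zero => exact hf.1
      | succ p ih =>
        rw [Function.iterate_succ_apply']
        exact ((contDiffOn_infty_iff_deriv_of_isOpen isOpen_Ioi).1 ih).2
    simp only [Function.iterate_succ_apply']
    exact (((contDiffOn_infty_iff_deriv_of_isOpen isOpen_Ioi).1 (h p)).1.differentiableAt
      (Ioi_mem_nhds hx)).hasDerivAt
  bounded N := by
    have h : ∀ᶠ M : ℝ in atTop, ∀ p ∈ Set.Iic N, ∀ k ∈ Set.Iic N, ∀ x > (0 : ℝ),
        x ^ k * ‖deriv^[p] f x‖ ≤ M := by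
      rw [(Set.finite_Iic N).eventually_all]
      intro p _
      rw [(Set.finite_Iic N).eventually_all]
      intro k _
      obtain ⟨C, hC⟩ := hf.2.2 k p
      filter_upwards [eventually_ge_atTop C] with M hM x hx using (hC x hx).trans hM
    exact h.exists

theorem iterate_deriv_hankelIntegral {F : ℕ → ℝ → ℂ} (hF : IsSchwartzJet F) {γ c : ℝ}
    (hγ : 0 ≤ γ) (hc : 0 ≤ c) (a : ℂ) (p : ℕ) :
    ∀ t > (0 : ℝ), deriv^[p] (fun s => a * hankelIntegral γ c (F 0) s) t =
      a * (-c) ^ p * hankelIntegral (γ + p) c (F 0) t := by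
  induction p with
  | zero => simp
  | succ p ih =>
    intro t ht
    have hγp : 0 ≤ γ + p := by positivity
    obtain ⟨M, hM⟩ := hF.exists_decayBound 0 (⌈γ + p⌉₊ + 2)
    obtain ⟨M', hM'⟩ := hF.exists_decayBound 0 (⌈γ + p + 1⌉₊ + 2)
    have h := (hasDerivAt_hankelIntegral hγp hc (hF.continuousOn 0) hM hM' ht).const_mul
      (a * (-c) ^ p)
    rw [Function.iterate_succ_apply', EventuallyEq.deriv_eq (f := fun t =>
      a * (-c) ^ p * hankelIntegral (γ + p) c (F 0) t) (eventually_of_mem (Ioi_mem_nhds ht) ih),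
      h.deriv, Complex.real_smul, Nat.cast_succ, ← add_assoc]
    push_cast
    ring

theorem contDiffOn_hankelIntegral {F : ℕ → ℝ → ℂ} (hF : IsSchwartzJet F) {γ c : ℝ} (hγ : 0 ≤ γ)
    (hc : 0 ≤ c) : ContDiffOn ℝ (⊤ : ℕ∞) (hankelIntegral γ c (F 0)) (Set.Ioi 0) := by
  rw [contDiffOn_infty]
  intro n
  induction n generalizing γ with
  | zero =>
    obtain ⟨M, hM⟩ := hF.exists_decayBound 0 (⌈γ⌉₊ + 2)
    exact contDiffOn_zero.2
      ((continuousOn_hankelIntegral hγ hc (hF.continuousOn 0) hM).mono Set.Ioi_subset_Ici_self)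
  | succ n ih =>
    obtain ⟨M, hM⟩ := hF.exists_decayBound 0 (⌈γ⌉₊ + 2)
    obtain ⟨M', hM'⟩ := hF.exists_decayBound 0 (⌈γ + 1⌉₊ + 2)
    have h : ∀ t ∈ Set.Ioi (0 : ℝ), HasDerivAt (hankelIntegral γ c (F 0))
        (-c • hankelIntegral (γ + 1) c (F 0) t) t :=
      fun t ht => hasDerivAt_hankelIntegral hγ hc (hF.continuousOn 0) hM hM' ht
    rw [Nat.cast_succ, contDiffOn_succ_iff_deriv_of_isOpen isOpen_Ioi]
    refine ⟨fun t ht => (h t ht).differentiableAt.differentiableWithinAt, by simp, ?_⟩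
    exact ((ih (γ := γ + 1) (by positivity)).const_smul (-c)).congr fun t ht => (h t ht).deriv

/-- On the unit circle the kernel of `J1` is evaluated on the negative half-line. -/
theorem div_one_sub_sq_eq {z : ℂ} (hz : ‖z‖ = 1) (hz1 : z ≠ 1) :
    z / (1 - z) ^ 2 = ((-(Complex.normSq (1 - z))⁻¹ : ℝ) : ℂ) := by
  have h1 : 1 - z ≠ 0 := sub_ne_zero.2 hz1.symm
  have h2 : (Complex.normSq (1 - z) : ℂ) ≠ 0 := by
    exact_mod_cast (Complex.normSq_pos.2 h1).ne'
  have h3 : z * (starRingEnd ℂ) z = 1 := by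
    rw [Complex.mul_conj, Complex.normSq_eq_norm_sq, hz]; simp
  rw [Complex.ofReal_neg, Complex.ofReal_inv, div_eq_iff (pow_ne_zero 2 h1),
    ← mul_right_inj' h2, neg_mul, mul_neg, mul_inv_cancel_left₀ h2, ← Complex.mul_conj,
    map_sub, map_one]
  linear_combination (z - 1) * h3

theorem J1_eq {z : ℂ} (hz : ‖z‖ = 1) (hz1 : z ≠ 1) (γ : ℝ) (f : ℝ → ℂ) :
    J1 z γ f = fun t => (1 - z) ^ ((-1 : ℂ) - (γ : ℂ)) *
      hankelIntegral γ (Complex.normSq (1 - z))⁻¹ f t := by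
  funext t
  unfold J1 hankelIntegral
  congr 1
  refine setIntegral_congr_fun measurableSet_Ioi fun x hx => ?_
  have hu : (x : ℂ) * (t : ℂ) * z / (1 - z) ^ 2 =
      ((-((Complex.normSq (1 - z))⁻¹ * x * t) : ℝ) : ℂ) := by
    rw [mul_div_assoc, div_one_sub_sq_eq hz hz1]
    push_cast
    ring
  simp only [hu, Kfun_ofReal, Complex.real_smul, Complex.ofReal_mul,
    Complex.ofReal_cpow (le_of_lt hx)]
  ring

/-- For `γ ≥ 0`, `|z| = 1`, `z ≠ 1`, the transform `J_{z,γ}` maps `S(ℝ₊)` into `S(ℝ₊)`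
continuously: for every `j` there are `C > 0` and `j'` with `q_j(J_{z,γ}f) ≤ C q_{j'}(f)`. -/
theorem stmt3 (γ : ℝ) (hγ : 0 ≤ γ) (z : ℂ) (hz : ‖z‖ = 1) (hz1 : z ≠ 1) :
    (∀ f : ℝ → ℂ, IsSPlus1 f → IsSPlus1 (J1 z γ f)) ∧
    (∀ j : ℕ, ∃ C > (0:ℝ), ∃ j' : ℕ, ∀ f : ℝ → ℂ, IsSPlus1 f → ∀ M : ℝ,
      (∀ p ≤ j', ∀ k ≤ j', ∀ t > (0:ℝ), t ^ k * ‖deriv^[p] f t‖ ≤ M) →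
      (∀ p ≤ j, ∀ k ≤ j, ∀ t > (0:ℝ), t ^ k * ‖deriv^[p] (J1 z γ f) t‖ ≤ C * M)) := by
  have hc : 0 < (Complex.normSq (1 - z))⁻¹ :=
    inv_pos.2 (Complex.normSq_pos.2 (sub_ne_zero.2 hz1.symm))
  have hderiv : ∀ f : ℝ → ℂ, IsSPlus1 f → ∀ p : ℕ, ∀ t > (0 : ℝ), deriv^[p] (J1 z γ f) t =
      (1 - z) ^ ((-1 : ℂ) - (γ : ℂ)) * (-((Complex.normSq (1 - z))⁻¹ : ℝ)) ^ p *
        hankelIntegral (γ + p) (Complex.normSq (1 - z))⁻¹ f t := fun f hf p t ht => by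
    rw [J1_eq hz hz1]
    exact iterate_deriv_hankelIntegral hf.isSchwartzJet hγ hc.le _ p t ht
  have hbound : ∀ p k : ℕ, ∃ C ≥ (0 : ℝ), ∃ N : ℕ, ∀ f, IsSPlus1 f → ∀ M,
      JetBound (fun p => deriv^[p] f) N M →
        ∀ t > (0 : ℝ), t ^ k * ‖deriv^[p] (J1 z γ f) t‖ ≤ C * M := fun p k => by
    obtain ⟨C, hC, N, h⟩ :=
      exists_pow_mul_norm_hankelIntegral_le (γ := γ + p) (by positivity) hc k
    refine ⟨‖(1 - z) ^ ((-1 : ℂ) - (γ : ℂ)) * (-((Complex.normSq (1 - z))⁻¹ : ℝ)) ^ p‖ * C,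
      by positivity, N, fun f hf M hM t ht => ?_⟩
    rw [hderiv f hf p t ht, norm_mul, mul_left_comm, mul_assoc]
    refine mul_le_mul_of_nonneg_left ?_ (norm_nonneg _)
    exact h _ hf.isSchwartzJet M hM t ht
  refine ⟨fun f hf => ⟨?_, fun p => ?_, fun k p => ?_⟩, fun j => ?_⟩
  · rw [J1_eq hz hz1]
    exact contDiffOn_const.mul (contDiffOn_hankelIntegral hf.isSchwartzJet hγ hc.le)
  · obtain ⟨M, hM⟩ := hf.isSchwartzJet.exists_decayBound 0 (⌈γ + p⌉₊ + 2)
    exact ⟨_, continuousOn_const.mul (continuousOn_hankelIntegral (by positivity) hc.le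
      (hf.isSchwartzJet.continuousOn 0) hM), fun t ht => (hderiv f hf p t ht).symm⟩
  · obtain ⟨C, _, N, h⟩ := hbound p k
    obtain ⟨M, hM⟩ := hf.isSchwartzJet.bounded N
    exact ⟨C * M, h f hf M hM⟩
  · have huniform : ∀ᶠ n : ℕ in atTop, ∀ p ∈ Set.Iic j, ∀ k ∈ Set.Iic j, ∀ f, IsSPlus1 f → ∀ M,
        JetBound (fun p => deriv^[p] f) n M →
          ∀ t > (0 : ℝ), t ^ k * ‖deriv^[p] (J1 z γ f) t‖ ≤ (n + 1) * M := by
      rw [(Set.finite_Iic j).eventually_all]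
      intro p _
      rw [(Set.finite_Iic j).eventually_all]
      intro k _
      obtain ⟨C, _, N, h⟩ := hbound p k
      filter_upwards [eventually_ge_atTop N, eventually_ge_atTop ⌈C⌉₊] with n hN hCn f hf M hM t ht
      have hM0 : 0 ≤ M := (hM 0 n.zero_le).nonneg
      have hCn' : C ≤ n + 1 := by
        have : C ≤ n := (Nat.le_ceil C).trans (by exact_mod_cast hCn)
        linarith
      exact (h f hf M (hM.mono hN) t ht).trans (by gcongr)
    obtain ⟨n, hn⟩ := huniform.exists
    exact ⟨n + 1, by positivity, n, fun f hf M hM p hp k hk => hn p hp k hk f hf M hM⟩
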